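/- Let K be a field, R = K[x,y,z,t], and let d ≥ 1 be an integer. Then the following equality of ideals of R holds: (xz − yt, y^d) = ((xz − yt) + (x,y)^d) ∩ ((xz − yt) + (y,z)^d). -/

import Mathlib

open MvPolynomial

/-- If an endomorphism `ψ` of a domain is the identity modulo `(x, y)`, kills `q`, and sends
`x` and `y` to multiples `x * b` and `x * c` of the prime `x` with `¬ x ∣ c`, then
`y ^ n * g ∈ (q) + (x, y) ^ (n + 1)` forces `g ∈ (x, y)`. -/
theorem mem_span_pair_of_pow_mul_mem {R : Type*} [CommRing R] [IsDomain R] {q x y b c g : R}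
    {n : ℕ} (ψ : R →+* R) (hψ : ∀ r, r - ψ r ∈ Ideal.span {x, y}) (hq : ψ q = 0)
    (hx : ψ x = x * b) (hy : ψ y = x * c) (hprime : Prime x) (hc : ¬ x ∣ c)
    (h : y ^ n * g ∈ Ideal.span {q} + Ideal.span {x, y} ^ (n + 1)) :
    g ∈ Ideal.span {x, y} := by
  have hle : Ideal.span {x, y} ≤ (Ideal.span {x}).comap ψ := by
    rw [Ideal.span_le]
    rintro r (rfl | rfl)
    · exact Ideal.mem_span_singleton.2 ⟨b, hx⟩
    · exact Ideal.mem_span_singleton.2 ⟨c, hy⟩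
  have hpow : Ideal.span {q} + Ideal.span {x, y} ^ (n + 1) ≤
      (Ideal.span {x ^ (n + 1)}).comap ψ := by
    refine sup_le ?_ ?_
    · rw [Ideal.span_singleton_le_iff_mem, Ideal.mem_comap, hq]
      exact zero_mem _
    · rw [← Ideal.span_singleton_pow]
      exact (Ideal.pow_right_mono hle _).trans (Ideal.le_comap_pow ψ _)
  have hdvd := Ideal.mem_span_singleton.1 (hpow h)
  rw [map_mul, map_pow, hy, mul_pow, pow_succ, mul_assoc,
    mul_dvd_mul_iff_left (pow_ne_zero n hprime.ne_zero)] at hdvd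
  obtain hd | ⟨e, he⟩ := hprime.dvd_or_dvd hdvd
  · exact absurd (hprime.dvd_of_dvd_pow hd) hc
  · have hmem : ψ g ∈ Ideal.span {x, y} := by
      rw [he]
      exact Ideal.mul_mem_right _ _ (Ideal.subset_span (by simp))
    simpa using add_mem (hψ g) hmem

/-- To check that an endomorphism of a polynomial ring is the identity modulo an ideal, it
suffices to look at the variables. -/
theorem MvPolynomial.sub_aeval_mem {σ K : Type*} [CommRing K] {I : Ideal (MvPolynomial σ K)}
    {f : σ → MvPolynomial σ K} (hf : ∀ i, X i - f i ∈ I) (p : MvPolynomial σ K) :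
    p - aeval f p ∈ I := by
  have h : (Ideal.Quotient.mkₐ K I).comp (aeval f) = Ideal.Quotient.mkₐ K I := by
    ext i
    simpa using (Ideal.Quotient.eq.2 (hf i)).symm
  exact Ideal.Quotient.eq.1 (DFunLike.congr_fun h p).symm

theorem MvPolynomial.not_X_dvd_X {σ K : Type*} [CommRing K] [Nontrivial K] {i j : σ}
    (h : i ≠ j) : ¬ (X i : MvPolynomial σ K) ∣ X j := by
  rw [X_dvd_X]
  simpa using h

/-- The lines `{x = y = 0}` and `{y = z = 0}` are linked by `(xz - yt, y)`. -/
theorem mem_span_quadric_of_mem_lines {K : Type*} [Field K] {g : MvPolynomial (Fin 4) K}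
    (h₁ : g ∈ Ideal.span {X 0, X 1}) (h₂ : g ∈ Ideal.span {X 1, X 2}) :
    g ∈ Ideal.span {X 0 * X 2 - X 1 * X 3, X 1} := by
  obtain ⟨α, β, rfl⟩ := Ideal.mem_span_pair.1 h₁
  obtain ⟨u, v, huv⟩ := Ideal.mem_span_pair.1 h₂
  let f : Fin 4 → MvPolynomial (Fin 4) K := ![X 0, 0, 0, X 3]
  have hα : aeval f α = 0 := by
    have h := congrArg (aeval f) huv
    simpa [f, X_ne_zero] using h
  have hmem : α ∈ Ideal.span {X 1, X 2} := by
    have h := sub_aeval_mem (I := Ideal.span {X 1, X 2}) (f := f) (fun i => by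
      fin_cases i
      · simp [f]
      · simpa [f] using Ideal.subset_span (by simp)
      · simpa [f] using Ideal.subset_span (by simp)
      · simp [f]) α
    rwa [hα, sub_zero] at h
  obtain ⟨γ, δ, rfl⟩ := Ideal.mem_span_pair.1 hmem
  exact Ideal.mem_span_pair.2 ⟨δ, δ * X 3 + γ * X 0 + β, by ring⟩

/-- The inductive step of the linkage: an element `y ^ n * g` lying on both `(n + 1)`-fold lines
lies in `(xz - yt, y ^ (n + 1))`. -/
theorem mem_span_quadric_of_pow_mul_mem {K : Type*} [Field K] {n : ℕ}
    {g : MvPolynomial (Fin 4) K}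
    (h₁ : X 1 ^ n * g ∈
      Ideal.span {X 0 * X 2 - X 1 * X 3} + Ideal.span {X 0, X 1} ^ (n + 1))
    (h₂ : X 1 ^ n * g ∈
      Ideal.span {X 0 * X 2 - X 1 * X 3} + Ideal.span {X 1, X 2} ^ (n + 1)) :
    X 1 ^ n * g ∈ Ideal.span {X 0 * X 2 - X 1 * X 3, X 1 ^ (n + 1)} := by
  have hg₁ : g ∈ Ideal.span {X 0, X 1} := by
    let f : Fin 4 → MvPolynomial (Fin 4) K := ![X 0 * X 3, X 0 * X 2, X 2, X 3]
    refine mem_span_pair_of_pow_mul_mem (b := X 3) (c := X 2) (aeval f).toRingHom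
      (sub_aeval_mem fun i => ?_) ?_ ?_ ?_ X_prime (not_X_dvd_X (by decide)) h₁
    · rw [Ideal.mem_span_pair]
      fin_cases i
      · exact ⟨1 - X 3, 0, by simp [f]; ring⟩
      · exact ⟨-X 2, 1, by simp [f]; ring⟩
      · exact ⟨0, 0, by simp [f]⟩
      · exact ⟨0, 0, by simp [f]⟩
    · simp [f]; ring
    · simp [f]
    · simp [f]
  have hg₂ : g ∈ Ideal.span {X 1, X 2} := by
    rw [Set.pair_comm] at h₂ ⊢
    let f : Fin 4 → MvPolynomial (Fin 4) K := ![X 0, X 2 * X 0, X 2 * X 3, X 3]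
    refine mem_span_pair_of_pow_mul_mem (b := X 3) (c := X 0) (aeval f).toRingHom
      (sub_aeval_mem fun i => ?_) ?_ ?_ ?_ X_prime (not_X_dvd_X (by decide)) h₂
    · rw [Ideal.mem_span_pair]
      fin_cases i
      · exact ⟨0, 0, by simp [f]⟩
      · exact ⟨-X 0, 1, by simp [f]; ring⟩
      · exact ⟨1 - X 3, 0, by simp [f]; ring⟩
      · exact ⟨0, 0, by simp [f]⟩
    · simp [f]; ring
    · simp [f]
    · simp [f]
  obtain ⟨u, v, rfl⟩ := Ideal.mem_span_pair.1 (mem_span_quadric_of_mem_lines hg₁ hg₂)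
  exact Ideal.mem_span_pair.2 ⟨X 1 ^ n * u, v, by ring⟩

/-- The geometric linkage identity in the proof of Corollary 3.2 of "The equations of
space curves on a quadric" by Di Gennaro and Nagel: the `d`-fold lines on the smooth
quadric `{xz - yt = 0}` supported on `{x = y = 0}` and `{y = z = 0}` are geometrically
linked by the complete intersection `(xz - yt, y^d)`, i.e.
`(xz - yt, y^d) = ((xz - yt) + (x,y)^d) ∩ ((xz - yt) + (y,z)^d)`. -/
theorem linkage_smooth_quadric
    {K : Type*} [Field K] (d : ℕ) (hd : 1 ≤ d) :
    (Ideal.span {X 0 * X 2 - X 1 * X 3, X 1 ^ d} : Ideal (MvPolynomial (Fin 4) K)) =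
      (Ideal.span {X 0 * X 2 - X 1 * X 3} +
          (Ideal.span {X 0, X 1} : Ideal (MvPolynomial (Fin 4) K)) ^ d) ⊓
        (Ideal.span {X 0 * X 2 - X 1 * X 3} +
          (Ideal.span {X 1, X 2} : Ideal (MvPolynomial (Fin 4) K)) ^ d) := by
  refine le_antisymm ?_ ?_
  · rw [Ideal.span_insert]
    refine le_inf (sup_le_sup_left ?_ _) (sup_le_sup_left ?_ _) <;>
    · rw [Ideal.span_singleton_le_iff_mem]
      exact Ideal.pow_mem_pow (Ideal.subset_span (by simp)) d
  · clear hd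
    induction d with
    | zero => simp [Ideal.span_insert]
    | succ n ih =>
      rintro p ⟨h₁, h₂⟩
      have hle (J : Ideal (MvPolynomial (Fin 4) K)) :
          Ideal.span {X 0 * X 2 - X 1 * X 3} + J ^ (n + 1) ≤
            Ideal.span {X 0 * X 2 - X 1 * X 3} + J ^ n :=
        sup_le_sup_left (Ideal.pow_le_pow_right n.le_succ) _
      obtain ⟨u, g, rfl⟩ := Ideal.mem_span_pair.1 (ih
        ⟨hle _ h₁, hle _ h₂⟩)
      have hq (J : Ideal (MvPolynomial (Fin 4) K)) :
          u * (X 0 * X 2 - X 1 * X 3) ∈ Ideal.span {X 0 * X 2 - X 1 * X 3} + J :=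
        Ideal.mul_mem_left _ _ (Ideal.mem_sup_left (Ideal.mem_span_singleton_self _))
      have hg := mem_span_quadric_of_pow_mul_mem (n := n) (g := g)
        (by simpa only [mul_comm g] using (Ideal.add_mem_iff_right _ (hq _)).1 h₁)
        (by simpa only [mul_comm g] using (Ideal.add_mem_iff_right _ (hq _)).1 h₂)
      rw [mul_comm g]
      exact add_mem (Ideal.mul_mem_left _ _ (Ideal.subset_span (by simp))) hg
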